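/- Let R be a commutative ring, A a commutative R-algebra, V and W R-modules, and α, β alternating 2-forms on V with values in A. For i ∈ {1,2,3} let αᵢ (resp. βᵢ) denote the pullback of α (resp. β) along the i-th projection V × V × V → V, and set Ω := (α₁ + α₂ + α₃) ∧ (β₁ + β₂ + β₃). Let g : W →ₗ[R] V × V × V be a linear map such that the pullbacks along g of α₁, α₂, β₁, and β₂ are all the zero form. Then the pullback of Ω along g equals the pullback of α₃ ∧ β₃ along g. -/

import Mathlib

open scoped TensorProduct

/-- The wedge product of two alternating 2-forms on an `R`-module `V` with values in a
commutative `R`-algebra `A`: the alternating 4-form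
`(α ∧ β)(v₁,v₂,v₃,v₄) = Σ ε(i,j,k,l) · α(v_i,v_j) · β(v_k,v_l)`, obtained from
`AlternatingMap.domCoprod` composed with the multiplication `A ⊗[R] A → A` and
reindexed along `Fin 2 ⊕ Fin 2 ≃ Fin 4`. -/
noncomputable def wedge {R A V : Type*} [CommRing R] [CommRing A] [Algebra R A]
    [AddCommGroup V] [Module R V]
    (α β : AlternatingMap R V A (Fin 2)) : AlternatingMap R V A (Fin 4) :=
  AlternatingMap.domDomCongr finSumFinEquiv
    ((LinearMap.mul' R A).compAlternatingMap (AlternatingMap.domCoprod α β))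

/-- Pulling back commutes with `AlternatingMap.domCoprod`. -/
theorem AlternatingMap.domCoprod_compLinearMap {R ι₁ ι₂ M M' N₁ N₂ : Type*} [CommRing R]
    [Fintype ι₁] [Fintype ι₂] [DecidableEq ι₁] [DecidableEq ι₂]
    [AddCommGroup M] [Module R M] [AddCommGroup M'] [Module R M']
    [AddCommGroup N₁] [Module R N₁] [AddCommGroup N₂] [Module R N₂]
    (a : AlternatingMap R M N₁ ι₁) (b : AlternatingMap R M N₂ ι₂) (g : M' →ₗ[R] M) :
    (a.domCoprod b).compLinearMap g = (a.compLinearMap g).domCoprod (b.compLinearMap g) := by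
  ext v
  simp only [compLinearMap_apply, domCoprod_apply, _root_.sum_apply]
  refine Finset.sum_congr rfl fun σ _ => ?_
  induction σ using Quotient.inductionOn'
  rfl

/-- Pulling back commutes with the wedge product. -/
theorem wedge_compLinearMap {R A V W : Type*} [CommRing R] [CommRing A] [Algebra R A]
    [AddCommGroup V] [Module R V] [AddCommGroup W] [Module R W]
    (α β : AlternatingMap R V A (Fin 2)) (g : W →ₗ[R] V) :
    (wedge α β).compLinearMap g = wedge (α.compLinearMap g) (β.compLinearMap g) := by
  rw [wedge, wedge, ← AlternatingMap.domCoprod_compLinearMap]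
  rfl

/-- with `Ω := (α₁+α₂+α₃) ∧ (β₁+β₂+β₃)` on `V × V × V`, if
`g : W →ₗ[R] V × V × V` pulls back `α₁, α₂, β₁, β₂` to zero, then `g*Ω = g*(α₃ ∧ β₃)`. -/
theorem pullback_wedge_eq_pullback_third_wedge_of_vanishing
    {R A V W : Type*} [CommRing R] [CommRing A] [Algebra R A]
    [AddCommGroup V] [Module R V] [AddCommGroup W] [Module R W]
    (α β : AlternatingMap R V A (Fin 2)) (g : W →ₗ[R] V × V × V)
    (hα₁ : (α.compLinearMap (LinearMap.fst R V (V × V))).compLinearMap g = 0)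
    (hα₂ : (α.compLinearMap ((LinearMap.fst R V V) ∘ₗ
      (LinearMap.snd R V (V × V)))).compLinearMap g = 0)
    (hβ₁ : (β.compLinearMap (LinearMap.fst R V (V × V))).compLinearMap g = 0)
    (hβ₂ : (β.compLinearMap ((LinearMap.fst R V V) ∘ₗ
      (LinearMap.snd R V (V × V)))).compLinearMap g = 0) :
    (wedge
        (α.compLinearMap (LinearMap.fst R V (V × V)) +
          α.compLinearMap ((LinearMap.fst R V V) ∘ₗ (LinearMap.snd R V (V × V))) +
          α.compLinearMap ((LinearMap.snd R V V) ∘ₗ (LinearMap.snd R V (V × V))))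
        (β.compLinearMap (LinearMap.fst R V (V × V)) +
          β.compLinearMap ((LinearMap.fst R V V) ∘ₗ (LinearMap.snd R V (V × V))) +
          β.compLinearMap ((LinearMap.snd R V V) ∘ₗ (LinearMap.snd R V (V × V))))).compLinearMap g =
      (wedge
        (α.compLinearMap ((LinearMap.snd R V V) ∘ₗ (LinearMap.snd R V (V × V))))
        (β.compLinearMap ((LinearMap.snd R V V) ∘ₗ (LinearMap.snd R V (V × V))))).compLinearMap g := by
  simp only [wedge_compLinearMap, AlternatingMap.add_compLinearMap, hα₁, hα₂, hβ₁, hβ₂, zero_add]
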